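/- Let A be an affine subspace of ℝ^n with ∅ ≠ A ∩ B₁ ⊆ ∂B₁. Let x̄ ∈ A ∩ ∂B₁, s̄ = sign(D*x̄), and J̄ = cosupp(D*x̄). Then: (i) dir(A) ⊆ ⋃_{s ≽ s̄} {d ∈ ℝ^n : ⟨Ds, d⟩ ≥ 0}; (ii) dir(A)⊥ ∩ (∑_{s ≽ s̄} ℝ₊·Ds) ≠ {0}; (iii) dir(A) ∩ Ker D*_J̄ ⊆ (Ds̄)⊥; (iv) A ∩ {x : sign(D*x) ≼ s̄} ⊆ ∂B₁; (v) A ∩ {x : sign(D*x) = s̄} ⊆ ∂B₁. -/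

import Mathlib

open Matrix Set

noncomputable section

/-- `Vec n` is `ℝ^n`. -/
abbrev Vec (n : ℕ) := Fin n → ℝ

/-- The ℓ¹-norm on `ℝ^p`. -/
def l1 {p : ℕ} (θ : Vec p) : ℝ := ∑ i, |θ i|

/-- The componentwise sign vector. -/
def sgn {p : ℕ} (θ : Vec p) : Vec p := fun i => Real.sign (θ i)

/-- `s` is a sign vector, i.e. `s ∈ {-1,0,1}^p`. -/
def IsSignVec {p : ℕ} (s : Vec p) : Prop := ∀ i, s i = -1 ∨ s i = 0 ∨ s i = 1

/-- The order `s ≼ s'` on sign vectors: `sᵢ ≠ 0 → s'ᵢ = sᵢ`. -/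
def sleq {p : ℕ} (s s' : Vec p) : Prop := ∀ i, s i ≠ 0 → s' i = s i

/-- The cosupport `{i : uᵢ = 0}`. -/
def cosupp {p : ℕ} (u : Vec p) : Set (Fin p) := {i | u i = 0}

/-- The analysis operator `D* x = Dᵀ x`. -/
def Dstar {n p : ℕ} (D : Matrix (Fin n) (Fin p) ℝ) (x : Vec n) : Vec p := Dᵀ *ᵥ x

/-- The ball `B_r = {x : ‖D*x‖₁ ≤ r}`. -/
def Ball {n p : ℕ} (D : Matrix (Fin n) (Fin p) ℝ) (r : ℝ) : Set (Vec n) :=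
  {x | l1 (Dstar D x) ≤ r}

/-- The sphere `∂B_r = {x : ‖D*x‖₁ = r}`. -/
def Sph {n p : ℕ} (D : Matrix (Fin n) (Fin p) ℝ) (r : ℝ) : Set (Vec n) :=
  {x | l1 (Dstar D x) = r}

/-- `Ker D*_J = {x : (D*x)ᵢ = 0 for all i ∈ J}`. -/
def kerDJ {n p : ℕ} (D : Matrix (Fin n) (Fin p) ℝ) (J : Set (Fin p)) : Set (Vec n) :=
  {x | ∀ i ∈ J, Dstar D x i = 0}

/-- The relative interior of a set. -/
def ri {n : ℕ} (C : Set (Vec n)) : Set (Vec n) := intrinsicInterior ℝ C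

/-- The direction of (the affine hull of) a set, as a set of vectors. -/
def dir {n : ℕ} (C : Set (Vec n)) : Set (Vec n) := ((affineSpan ℝ C).direction : Set (Vec n))

/-- `F` is an exposed face of `X`: the intersection of `X` with a supporting hyperplane. -/
def IsExposedFace {n : ℕ} (X F : Set (Vec n)) : Prop :=
  ∃ (α : Vec n) (β : ℝ), α ≠ 0 ∧ (∀ x ∈ X, α ⬝ᵥ x ≤ β) ∧ F = X ∩ {x | α ⬝ᵥ x = β}

/-- `G` is a face of `X`: a convex extreme subset of `X`. -/
def IsFace {n : ℕ} (X G : Set (Vec n)) : Prop := Convex ℝ G ∧ IsExtreme ℝ X G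

/-- `x` is an extreme point of `C`: it is not the midpoint of two distinct points of `C`. -/
def IsExtremePt {n : ℕ} (C : Set (Vec n)) (x : Vec n) : Prop :=
  x ∈ C ∧ ∀ x₁ ∈ C, ∀ x₂ ∈ C, x = midpoint ℝ x₁ x₂ → x₁ = x₂

/-- The objective `L(x) = (1/2)‖y − Φx‖₂² + λ‖D*x‖₁`. -/
def Lfun {n p q : ℕ} (D : Matrix (Fin n) (Fin p) ℝ) (Phi : Matrix (Fin q) (Fin n) ℝ)
    (y : Vec q) (lam : ℝ) (x : Vec n) : ℝ :=
  (1/2 : ℝ) * ((y - Phi *ᵥ x) ⬝ᵥ (y - Phi *ᵥ x)) + lam * l1 (Dstar D x)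

theorem aux_dot {n p : ℕ} (D : Matrix (Fin n) (Fin p) ℝ) (s : Vec p) (d : Vec n) :
    (D *ᵥ s) ⬝ᵥ d = ∑ i, s i * Dstar D d i := by
  have : (D *ᵥ s) ⬝ᵥ d = s ⬝ᵥ (Dᵀ *ᵥ d) := by
    rw [Matrix.mulVec_transpose, dotProduct_comm, Matrix.dotProduct_mulVec, dotProduct_comm]
  rw [this]; rfl

theorem aux_sign_mul (a : ℝ) : Real.sign a * a = |a| := by
  rcases lt_trichotomy a 0 with h | h | h
  · rw [Real.sign_of_neg h, abs_of_neg h]; ring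
  · simp [h]
  · rw [Real.sign_of_pos h, abs_of_pos h]; ring

theorem aux_sign_zero (a : ℝ) : Real.sign a = 0 ↔ a = 0 := Real.sign_eq_zero_iff

theorem aux_ev (u v : ℝ) : ∀ᶠ t in nhdsWithin (0 : ℝ) (Set.Ioi 0),
    |u + t * v| = |u| + t * ((if u = 0 then Real.sign v else Real.sign u) * v) := by
  have hc : Filter.Tendsto (fun t : ℝ => u + t * v) (nhdsWithin 0 (Set.Ioi 0)) (nhds u) := by
    have : Continuous (fun t : ℝ => u + t * v) := by fun_prop
    have h := this.tendsto 0
    simp only [zero_mul, add_zero] at h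
    exact h.mono_left nhdsWithin_le_nhds
  rcases lt_trichotomy u 0 with h | h | h
  · filter_upwards [hc.eventually (gt_mem_nhds h)] with t ht
    rw [abs_of_neg ht, abs_of_neg h, if_neg h.ne, Real.sign_of_neg h]; ring
  · filter_upwards [self_mem_nhdsWithin] with t ht
    have ht : 0 < t := ht
    rw [if_pos h, aux_sign_mul, h, abs_zero, zero_add, zero_add, abs_mul, abs_of_pos ht]
  · filter_upwards [hc.eventually (lt_mem_nhds h)] with t ht
    rw [abs_of_pos ht, abs_of_pos h, if_neg h.ne', Real.sign_of_pos h]; ring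

/-- properties of an affine subspace `A` with `∅ ≠ A ∩ B₁ ⊆ ∂B₁`, at a point
`x̄ ∈ A ∩ ∂B₁`, with `s̄ = sign(D*x̄)` and `J̄ = cosupp(D*x̄)`. -/
theorem stmt_7 {n p : ℕ} (hn : 0 < n) (hp : 0 < p) (D : Matrix (Fin n) (Fin p) ℝ)
    (A : AffineSubspace ℝ (Vec n))
    (hne : ((A : Set (Vec n)) ∩ Ball D 1).Nonempty)
    (hsub : (A : Set (Vec n)) ∩ Ball D 1 ⊆ Sph D 1)
    (xb : Vec n) (hxbA : xb ∈ A) (hxbS : xb ∈ Sph D 1)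
    (sb : Vec p) (hsb : sb = sgn (Dstar D xb))
    (Jb : Set (Fin p)) (hJb : Jb = cosupp (Dstar D xb)) :
    -- (i) dir(A) ⊆ ⋃_{s ≽ s̄} {d : ⟨Ds, d⟩ ≥ 0}
    (∀ d ∈ A.direction, ∃ s : Vec p, IsSignVec s ∧ sleq sb s ∧ 0 ≤ (D *ᵥ s) ⬝ᵥ d) ∧
    -- (ii) dir(A)⊥ ∩ (∑_{s ≽ s̄} ℝ₊·Ds) ≠ {0}
    (∃ d : Vec n, d ≠ 0 ∧ (∀ v ∈ A.direction, d ⬝ᵥ v = 0) ∧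
      ∃ (m : ℕ) (c : Fin m → ℝ) (σ : Fin m → Vec p),
        (∀ j, 0 ≤ c j) ∧ (∀ j, IsSignVec (σ j) ∧ sleq sb (σ j)) ∧
        d = ∑ j, c j • (D *ᵥ σ j)) ∧
    -- (iii) dir(A) ∩ Ker D*_J̄ ⊆ (Ds̄)⊥
    (∀ d ∈ A.direction, d ∈ kerDJ D Jb → (D *ᵥ sb) ⬝ᵥ d = 0) ∧
    -- (iv)
    ((A : Set (Vec n)) ∩ {x | sleq (sgn (Dstar D x)) sb} ⊆ Sph D 1) ∧
    -- (v)
    ((A : Set (Vec n)) ∩ {x | sgn (Dstar D x) = sb} ⊆ Sph D 1) := by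
  have hge : ∀ x ∈ A, 1 ≤ l1 (Dstar D x) := by
    intro x hx
    by_contra h
    push Not at h
    have := hsub ⟨hx, (h.le : l1 (Dstar D x) ≤ 1)⟩
    exact h.ne this
  have hxb1 : l1 (Dstar D xb) = 1 := hxbS
  have hi : ∀ d ∈ A.direction, ∃ s : Vec p, IsSignVec s ∧ sleq sb s ∧ 0 ≤ (D *ᵥ s) ⬝ᵥ d := by
    intro d hd
    refine ⟨fun i => if Dstar D xb i = 0 then Real.sign (Dstar D d i)
      else Real.sign (Dstar D xb i), ?_, ?_, ?_⟩
    · intro i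
      dsimp only
      split_ifs
      · rcases Real.sign_apply_eq (Dstar D d i) with h | h | h <;> simp [h]
      · rcases Real.sign_apply_eq (Dstar D xb i) with h | h | h <;> simp [h]
    · intro i hi
      subst hsb
      have : Dstar D xb i ≠ 0 := fun h => hi ((aux_sign_zero _).2 h)
      simp [this, sgn]
    · rw [aux_dot]
      have hev := Filter.eventually_all.2 (fun i => aux_ev (Dstar D xb i) (Dstar D d i))
      obtain ⟨t, ht, ht0⟩ := (hev.and self_mem_nhdsWithin).exists
      have ht0 : 0 < t := ht0
      have hmem : t • d + xb ∈ A := AffineSubspace.vadd_mem_of_mem_direction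
        (A.direction.smul_mem t hd) hxbA
      have h1 := hge _ hmem
      have h2 : l1 (Dstar D (t • d + xb)) = 1 + t * ∑ i, (if Dstar D xb i = 0 then
          Real.sign (Dstar D d i) else Real.sign (Dstar D xb i)) * Dstar D d i := by
        rw [← hxb1, l1, l1, Finset.mul_sum, ← Finset.sum_add_distrib]
        refine Finset.sum_congr rfl fun i _ => ?_
        rw [← ht i]
        simp [Dstar, Matrix.mulVec_add, Matrix.mulVec_smul, add_comm]
      rw [h2] at h1
      exact nonneg_of_mul_nonneg_right (by linarith) ht0
  have hiii0 : ∀ d ∈ A.direction, d ∈ kerDJ D Jb → 0 ≤ (D *ᵥ sb) ⬝ᵥ d := by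
    intro d hd hk
    obtain ⟨s, -, h2, h3⟩ := hi d hd
    rw [aux_dot] at h3 ⊢
    refine h3.trans_eq (Finset.sum_congr rfl fun i _ => ?_)
    by_cases h : Dstar D xb i = 0
    · have := hk i (by rw [hJb]; exact h)
      rw [this]; simp
    · rw [h2 i]
      rw [hsb]
      exact fun h' => h ((aux_sign_zero _).1 h')
  have hiii : ∀ d ∈ A.direction, d ∈ kerDJ D Jb → (D *ᵥ sb) ⬝ᵥ d = 0 := by
    intro d hd hk
    have h1 := hiii0 d hd hk
    have h2 := hiii0 (-d) (A.direction.neg_mem hd) (by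
      intro i hi
      have := hk i hi
      simp only [Dstar, Matrix.mulVec_neg, Pi.neg_apply] at this ⊢
      rw [this, neg_zero])
    rw [dotProduct_neg] at h2
    linarith
  have hone : ∀ s : Vec p, sleq sb s → (D *ᵥ s) ⬝ᵥ xb = 1 := by
    intro s hs
    rw [aux_dot, ← hxb1, l1]
    refine Finset.sum_congr rfl fun i _ => ?_
    rw [← aux_sign_mul]
    by_cases h : Dstar D xb i = 0
    · rw [h]; simp
    · rw [hs i, hsb]
      · rfl
      · rw [hsb]
        exact fun h' => h ((aux_sign_zero _).1 h')
  have hiv : (A : Set (Vec n)) ∩ {x | sleq (sgn (Dstar D x)) sb} ⊆ Sph D 1 := by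
    rintro x ⟨hxA, hx⟩
    have hx : sleq (sgn (Dstar D x)) sb := hx
    have hd : x - xb ∈ A.direction := AffineSubspace.vsub_mem_direction hxA hxbA
    have h0 := hiii _ hd (by
      intro i hi
      rw [hJb] at hi
      have hi : Dstar D xb i = 0 := hi
      have hxi : Dstar D x i = 0 := by
        by_contra h
        have h1 := hx i (fun h' => h ((aux_sign_zero _).1 h'))
        apply h
        apply (aux_sign_zero _).1
        change sgn (Dstar D x) i = 0
        rw [← h1, hsb, sgn, hi]; simp
      simp only [Dstar, Matrix.mulVec_sub, Pi.sub_apply] at hi hxi ⊢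
      rw [hi, hxi, sub_zero])
    rw [dotProduct_sub, hone sb (fun _ _ => rfl)] at h0
    have h1 : (D *ᵥ sb) ⬝ᵥ x = l1 (Dstar D x) := by
      rw [aux_dot, l1]
      refine Finset.sum_congr rfl fun i _ => ?_
      rw [← aux_sign_mul]
      by_cases h : Dstar D x i = 0
      · rw [h]; simp
      · rw [hx i (fun h' => h ((aux_sign_zero _).1 h'))]
        rfl
    change l1 (Dstar D x) = 1
    linarith
  refine ⟨hi, ?_, hiii, hiv, ?_⟩
  · let S : Set (Vec p) := {s | IsSignVec s ∧ sleq sb s}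
    have hS : S.Finite := by
      refine (Set.Finite.pi' (t := fun _ : Fin p => ({-1, 0, 1} : Set ℝ))
        (fun _ => Set.toFinite _)).subset ?_
      intro s hs i
      simpa using hs.1 i
    let K : Set (Vec n) := convexHull ℝ ((fun s => D *ᵥ s) '' S)
    let W : Submodule ℝ (Vec n) :=
      { carrier := {g | ∀ v ∈ A.direction, g ⬝ᵥ v = 0}
        add_mem' := fun {a b} ha hb v hv => by rw [add_dotProduct, ha v hv, hb v hv, add_zero]
        zero_mem' := fun v _ => zero_dotProduct v
        smul_mem' := fun c a ha v hv => by rw [smul_dotProduct, ha v hv, smul_zero] }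
    have hKc : IsCompact K := Set.Finite.isCompact_convexHull (𝕜 := ℝ) (hS.image _)
    have hnd : ¬ Disjoint K (W : Set (Vec n)) := by
      intro hdis
      obtain ⟨f, u, v, hfu, huv, hfv⟩ := geometric_hahn_banach_compact_closed
        (convex_convexHull ℝ _) hKc W.convex W.closed_of_finiteDimensional hdis
      have hv0 : v < 0 := by simpa using hfv 0 W.zero_mem
      have hfW : ∀ g ∈ W, f g = 0 := by
        intro g hg
        by_contra hne
        have := hfv ((v / f g) • g) (W.smul_mem _ hg)
        rw [map_smul, smul_eq_mul, div_mul_cancel₀ _ hne] at this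
        exact lt_irrefl _ this
      have hrep : ∀ φ : Vec n →ₗ[ℝ] ℝ, ∀ x, φ x = (fun i => φ (Pi.single i 1)) ⬝ᵥ x := by
        intro φ x
        rw [LinearMap.pi_apply_eq_sum_univ φ x, dotProduct]
        refine Finset.sum_congr rfl fun i _ => ?_
        rw [smul_eq_mul, mul_comm]
        congr 2
        ext j
        simp [Pi.single_apply, eq_comm]
      set d : Vec n := fun i => f (Pi.single i 1) with hd
      have hfd : ∀ x, f x = d ⬝ᵥ x := fun x => hrep f.toLinearMap x
      have hdA : d ∈ A.direction := by
        by_contra hnot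
        obtain ⟨φ, hφ, hle⟩ := Submodule.exists_le_ker_of_notMem hnot
        apply hφ
        rw [hrep φ d, dotProduct_comm, ← hfd]
        apply hfW
        intro w hw
        rw [← hrep φ w]
        exact hle hw
      obtain ⟨s, h1, h2, h3⟩ := hi d hdA
      have := hfu (D *ᵥ s) (subset_convexHull ℝ _ ⟨s, ⟨h1, h2⟩, rfl⟩)
      rw [hfd, dotProduct_comm] at this
      linarith
    obtain ⟨g, hgK, hgW⟩ := Set.not_disjoint_iff.1 hnd
    obtain ⟨ι, hι, w, z, hw0, hw1, hz, hsum⟩ := mem_convexHull_iff_exists_fintype.1 hgK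
    choose τ hτ hτz using hz
    refine ⟨g, ?_, hgW, Fintype.card ι, fun j => w ((Fintype.equivFin ι).symm j),
      fun j => τ ((Fintype.equivFin ι).symm j), fun j => hw0 _, fun j => hτ _, ?_⟩
    · intro hg0
      have : g ⬝ᵥ xb = 1 := by
        rw [← hsum, sum_dotProduct, ← hw1]
        refine Finset.sum_congr rfl fun i _ => ?_
        rw [smul_dotProduct, ← hτz]
        simp only
        rw [hone _ (hτ i).2, smul_eq_mul, mul_one]
      rw [hg0, zero_dotProduct] at this
      exact zero_ne_one this
    · rw [← hsum, (Fintype.equivFin ι).symm.sum_comp (fun i => w i • (D *ᵥ τ i))]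
      exact Finset.sum_congr rfl fun i _ => by rw [← hτz]
  · rintro x ⟨hxA, hx⟩
    refine hiv ⟨hxA, ?_⟩
    have hx : sgn (Dstar D x) = sb := hx
    change sleq _ _
    rw [hx]
    exact fun _ _ => rfl
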